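/- Let K be a field of characteristic 0 and A = A_0 ⊕ A_1 ⊕ A_2 an Artinian graded Gorenstein K-algebra with A_0 ≅ K, and let a = dim_K A_1 ∈ {0,1,2}. Then: (i) if a = 0, A is isomorphic as a graded K-algebra to K[X]/(X²) with deg X = 2; (ii) if a = 1, A ≅ K[X]/(X³) with deg X = 1; (iii) if a = 2, A ≅ K[X,Y]/(XY, X² − λY²) for some λ ∈ K ∖ {0}, with deg X = deg Y = 1. -/

import Mathlib

section GradedHelpers

variable {K A : Type*} [Field K] [CommRing A] [Algebra K A]

/-- If the span of `b` modulo an ideal `I` contains `1` and is stable under multiplication by a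
set of algebra generators, and an algebra map killing `I` sends `b` to a basis, then it induces an
isomorphism on the quotient by `I`. -/
theorem exists_quotient_algEquiv_of_basis {R ι : Type*} [CommRing R] [Algebra K R] [Fintype ι]
    {s : Set R} (hs : Algebra.adjoin K s = ⊤) (I : Ideal R) (f : R →ₐ[K] A)
    (hI : ∀ r ∈ I, f r = 0) (b : ι → R) (h1 : 1 ∈ Submodule.span K (Set.range b))
    (hmul : ∀ x ∈ s, ∀ i, x * b i ∈ Submodule.span K (Set.range b) ⊔ I.restrictScalars K)
    (hli : LinearIndependent K fun i => f (b i))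
    (hspan : ⊤ ≤ Submodule.span K (Set.range fun i => f (b i))) :
    ∃ e : (R ⧸ I) ≃ₐ[K] A, ∀ r, e (Ideal.Quotient.mk I r) = f r := by
  set T : Submodule K R := Submodule.span K (Set.range b) ⊔ I.restrictScalars K with hT
  have hIT : ∀ r ∈ I, r ∈ T := fun r hr => Submodule.mem_sup_right hr
  have hgen : ∀ x ∈ s, ∀ y ∈ T, x * y ∈ T := by
    intro x hx y hy
    have hle : T ≤ T.comap (LinearMap.mulLeft K x) := by
      refine sup_le (Submodule.span_le.2 ?_) ?_
      · rintro _ ⟨i, rfl⟩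
        exact hmul x hx i
      · intro r hr
        exact hIT _ (I.mul_mem_left x hr)
    exact hle hy
  have hmulT : ∀ r : R, ∀ y ∈ T, r * y ∈ T := by
    intro r
    have hr : r ∈ Algebra.adjoin K s := hs ▸ Algebra.mem_top
    induction hr using Algebra.adjoin_induction with
    | mem x hx => exact hgen x hx
    | algebraMap c =>
      intro y hy
      rw [← Algebra.smul_def]
      exact T.smul_mem c hy
    | add x y _ _ hx hy =>
      intro z hz
      rw [add_mul]
      exact T.add_mem (hx z hz) (hy z hz)
    | mul x y _ _ hx hy =>
      intro z hz
      rw [mul_assoc]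
      exact hx _ (hy z hz)
  have htop : ∀ r, r ∈ T := fun r => by
    simpa using hmulT r 1 (Submodule.mem_sup_left h1)
  refine ⟨AlgEquiv.ofBijective (Ideal.Quotient.liftₐ I f hI) ⟨?_, ?_⟩, fun r => rfl⟩
  · rw [injective_iff_map_eq_zero]
    intro q hq
    obtain ⟨r, rfl⟩ := Ideal.Quotient.mk_surjective q
    replace hq : f r = 0 := hq
    obtain ⟨y, hy, z, hz, rfl⟩ := Submodule.mem_sup.1 (htop r)
    obtain ⟨c, rfl⟩ := (Submodule.mem_span_range_iff_exists_fun K).1 hy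
    have hc := Fintype.linearIndependent_iff.1 hli c
      (by simpa [hI z hz] using hq)
    rw [Ideal.Quotient.eq_zero_iff_mem]
    simpa [hc] using hz
  · intro a
    obtain ⟨c, rfl⟩ := (Submodule.mem_span_range_iff_exists_fun K).1
      (hspan (Submodule.mem_top (x := a)))
    exact ⟨Ideal.Quotient.mk I (∑ i, c i • b i), by
      change f (∑ i, c i • b i) = _
      simp⟩

variable (𝒜 : ℕ → Submodule K A) [GradedAlgebra 𝒜]

theorem exists_add_add_eq_of_graded (htop : ∀ i, 2 < i → 𝒜 i = ⊥) (x : A) :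
    ∃ p ∈ 𝒜 0, ∃ q ∈ 𝒜 1, ∃ r ∈ 𝒜 2, p + q + r = x := by
  classical
  refine ⟨DirectSum.decompose 𝒜 x 0, SetLike.coe_mem _, DirectSum.decompose 𝒜 x 1,
    SetLike.coe_mem _, DirectSum.decompose 𝒜 x 2, SetLike.coe_mem _, ?_⟩
  conv_rhs => rw [← DirectSum.sum_support_decompose 𝒜 x]
  rw [Finset.sum_subset (s₂ := Finset.range 3)]
  · simp [Finset.sum_range_succ]
  · intro i hi
    rw [Finset.mem_range]
    by_contra h
    have hm : (DirectSum.decompose 𝒜 x i : A) = 0 :=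
      (Submodule.mem_bot K).1 ((htop i (by omega)).le (SetLike.coe_mem _))
    exact (DFinsupp.mem_support_iff.1 hi) (Subtype.ext hm)
  · intro i _ hi
    simpa using hi

theorem eq_zero_of_add_add_eq_zero {p q r : A} (hp : p ∈ 𝒜 0) (hq : q ∈ 𝒜 1) (hr : r ∈ 𝒜 2)
    (h : p + q + r = 0) : p = 0 ∧ q = 0 ∧ r = 0 := by
  have key : ∀ i, (DirectSum.decompose 𝒜 p i : A) + DirectSum.decompose 𝒜 q i
      + DirectSum.decompose 𝒜 r i = 0 := by
    intro i
    have := congrArg (fun t => (DirectSum.decompose 𝒜 t i : A)) h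
    simpa [DirectSum.decompose_add] using this
  have k0 := key 0
  have k1 := key 1
  have k2 := key 2
  simp only [DirectSum.decompose_of_mem 𝒜 hp, DirectSum.decompose_of_mem 𝒜 hq,
    DirectSum.decompose_of_mem 𝒜 hr, DirectSum.coe_of_apply] at k0 k1 k2
  simp at k0 k1 k2
  exact ⟨k0, k1, k2⟩

theorem mul_mem_graded_two {x y : A} (hx : x ∈ 𝒜 1) (hy : y ∈ 𝒜 1) : x * y ∈ 𝒜 2 :=
  SetLike.mul_mem_graded hx hy

theorem eq_zero_of_mem_graded_one_mul_mem_graded_two (h3 : 𝒜 3 = ⊥) {x y : A}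
    (hx : x ∈ 𝒜 1) (hy : y ∈ 𝒜 2) : x * y = 0 := by
  have h : x * y ∈ 𝒜 3 := SetLike.mul_mem_graded hx hy
  rwa [h3, Submodule.mem_bot] at h

/-- A nonzero vector of a submodule of rank one spans it. -/
theorem exists_smul_eq_of_mem_of_finrank_eq_one {V : Submodule K A} (hV : Module.finrank K V = 1)
    {w : A} (hw : w ∈ V) (hw0 : w ≠ 0) {x : A} (hx : x ∈ V) : ∃ c : K, c • w = x := by
  obtain ⟨c, hc⟩ := (finrank_eq_one_iff_of_nonzero' (⟨w, hw⟩ : V)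
    (by simpa [Subtype.ext_iff] using hw0)).1 hV ⟨x, hx⟩
  exact ⟨c, congrArg Subtype.val hc⟩

theorem exists_mem_ne_zero_of_finrank_eq_one {V : Submodule K A} (hV : Module.finrank K V = 1) :
    ∃ w ∈ V, w ≠ 0 := by
  apply V.exists_mem_ne_zero_of_ne_bot
  rintro rfl
  simp at hV

/-- A nondegenerate multiplication on a two-dimensional `𝒜 1` with values in a one-dimensional
`𝒜 2` can be diagonalized. -/
theorem exists_orthogonal_pair [CharZero K] [Module.Finite K A]
    (h2 : Module.finrank K (𝒜 2) = 1)
    (hnd : ∀ x ∈ 𝒜 1, x ≠ 0 → ∃ y ∈ 𝒜 1, x * y ≠ 0) (h1 : Module.finrank K (𝒜 1) = 2) :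
    ∃ u ∈ 𝒜 1, ∃ v ∈ 𝒜 1, u * v = 0 ∧ u * u ≠ 0 ∧ v * v ≠ 0 ∧
      ∀ x ∈ 𝒜 1, ∃ c d : K, c • u + d • v = x := by
  have hu : ∃ u ∈ 𝒜 1, u * u ≠ 0 := by
    by_contra! hsq
    obtain ⟨x, hx, hx0⟩ := (𝒜 1).exists_mem_ne_zero_of_ne_bot (by
      intro h
      rw [h] at h1
      simp at h1)
    obtain ⟨y, hy, hxy⟩ := hnd x hx hx0
    have h : (2 : K) • (x * y) = 0 := by
      rw [two_smul]
      linear_combination hsq _ (add_mem hx hy) - hsq x hx - hsq y hy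
    exact hxy ((smul_eq_zero.1 h).resolve_left two_ne_zero)
  obtain ⟨u, hu1, huu⟩ := hu
  have huu2 := mul_mem_graded_two 𝒜 hu1 hu1
  obtain ⟨v₀, hv₀, hv₀u⟩ : ∃ v ∈ 𝒜 1, v ∉ Submodule.span K {u} := by
    by_contra! h
    have hle := Submodule.finrank_mono (show 𝒜 1 ≤ Submodule.span K {u} from h)
    have := finrank_span_le_card (R := K) ({u} : Set A)
    simp at this
    omega
  obtain ⟨c, hc⟩ := exists_smul_eq_of_mem_of_finrank_eq_one h2 huu2 huu
    (mul_mem_graded_two 𝒜 hu1 hv₀)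
  have hv1 : v₀ - c • u ∈ 𝒜 1 := sub_mem hv₀ ((𝒜 1).smul_mem c hu1)
  have hv0 : v₀ - c • u ≠ 0 := by
    intro h
    exact hv₀u (Submodule.mem_span_singleton.2 ⟨c, (sub_eq_zero.1 h).symm⟩)
  have huv : u * (v₀ - c • u) = 0 := by
    rw [mul_sub, mul_smul_comm, hc, sub_self]
  generalize v₀ - c • u = v at hv1 hv0 huv
  have hli : LinearIndependent K ![u, v] := by
    rw [LinearIndependent.pair_iff]
    intro s t hst
    have hs : s • (u * u) = 0 := by
      have := congrArg (u * ·) hst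
      simpa [mul_add, huv] using this
    have hs0 := (smul_eq_zero.1 hs).resolve_right huu
    subst hs0
    exact ⟨rfl, (smul_eq_zero.1 (by simpa using hst)).resolve_right hv0⟩
  have hspan : Submodule.span K {u, v} = 𝒜 1 := by
    apply Submodule.eq_of_le_of_finrank_eq
    · rw [Submodule.span_le]
      rintro x (rfl | rfl) <;> assumption
    · have := finrank_span_eq_card hli
      rw [Matrix.range_cons_cons_empty] at this
      rw [h1, this, Fintype.card_fin]
  have hrep : ∀ x ∈ 𝒜 1, ∃ c d : K, c • u + d • v = x := fun x hx =>
    Submodule.mem_span_pair.1 (hspan ▸ hx)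
  refine ⟨u, hu1, v, hv1, huv, huu, ?_, hrep⟩
  intro hvv
  obtain ⟨y, hy, hvy⟩ := hnd v hv1 hv0
  obtain ⟨s, t, rfl⟩ := hrep y hy
  apply hvy
  simp [mul_add, hvv, mul_comm v u, huv]

end GradedHelpers


/-- Let `K` be a field of characteristic `0` and `A = A₀ ⊕ A₁ ⊕ A₂` an
Artinian graded Gorenstein `K`-algebra with `A₀ ≅ K`; Gorensteinness means `A₂ ≅ K` and the
symmetric bilinear form `(x,y) ↦ xy : A₁ × A₁ → A₂ ≅ K` is nondegenerate. Let
`a = dim_K A₁ ∈ {0,1,2}`. Then: (i) if `a = 0` then `A ≅ K[X]/(X²)` with `deg X = 2`;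
(ii) if `a = 1` then `A ≅ K[X]/(X³)` with `deg X = 1`; (iii) if `a = 2` then
`A ≅ K[X,Y]/(XY, X² - λY²)` for some `λ ≠ 0`, with `deg X = deg Y = 1`.
The graded algebra isomorphisms are expressed as algebra isomorphisms sending the
(algebra-generating) variables into the graded component of the indicated degree. -/
theorem statement4 (K : Type*) [Field K] [CharZero K]
    (A : Type*) [CommRing A] [Algebra K A] [Module.Finite K A]
    (𝒜 : ℕ → Submodule K A) [GradedAlgebra 𝒜]
    (htop : ∀ i, 2 < i → 𝒜 i = ⊥)
    (h0 : 𝒜 0 = Submodule.span K {1})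
    (h2 : Module.finrank K ↥(𝒜 2) = 1)
    (hnd : ∀ x ∈ 𝒜 1, x ≠ 0 → ∃ y ∈ 𝒜 1, x * y ≠ 0)
    (a : ℕ) (ha : Module.finrank K ↥(𝒜 1) = a) (ha2 : a ≤ 2) :
    (a = 0 → ∃ e : (Polynomial K ⧸ Ideal.span {(Polynomial.X : Polynomial K) ^ 2}) ≃ₐ[K] A,
        e (Ideal.Quotient.mk _ Polynomial.X) ∈ 𝒜 2) ∧
    (a = 1 → ∃ e : (Polynomial K ⧸ Ideal.span {(Polynomial.X : Polynomial K) ^ 3}) ≃ₐ[K] A,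
        e (Ideal.Quotient.mk _ Polynomial.X) ∈ 𝒜 1) ∧
    (a = 2 → ∃ l : K, l ≠ 0 ∧
      ∃ e : (MvPolynomial (Fin 2) K ⧸
          (Ideal.span {MvPolynomial.X 0 * MvPolynomial.X 1,
            (MvPolynomial.X 0 : MvPolynomial (Fin 2) K) ^ 2 -
              MvPolynomial.C l * MvPolynomial.X 1 ^ 2})) ≃ₐ[K] A,
        e (Ideal.Quotient.mk _ (MvPolynomial.X 0)) ∈ 𝒜 1 ∧
        e (Ideal.Quotient.mk _ (MvPolynomial.X 1)) ∈ 𝒜 1) := by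
  have hmul0 {x y : A} := eq_zero_of_mem_graded_one_mul_mem_graded_two 𝒜 (htop 3 (by norm_num))
    (x := x) (y := y)
  obtain ⟨w, hw, hw0⟩ := exists_mem_ne_zero_of_finrank_eq_one h2
  have hone : (1 : A) ≠ 0 := fun h => hw0 (by rw [← mul_one w, h, mul_zero])
  have hone0 : (1 : A) ∈ 𝒜 0 := h0 ▸ Submodule.mem_span_singleton_self 1
  have hrep0 : ∀ x ∈ 𝒜 0, ∃ c : K, c • 1 = x := fun x hx =>
    Submodule.mem_span_singleton.1 (h0 ▸ hx)
  have hrep2 {w x : A} (hw : w ∈ 𝒜 2) (hw0 : w ≠ 0) (hx : x ∈ 𝒜 2) :=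
    exists_smul_eq_of_mem_of_finrank_eq_one h2 hw hw0 hx
  refine ⟨?_, ?_, ?_⟩
  · rintro rfl
    have h1 : 𝒜 1 = ⊥ := Submodule.finrank_eq_zero.1 ha
    have hww : w * w = 0 := by
      have h : w * w ∈ 𝒜 4 := SetLike.mul_mem_graded hw hw
      rwa [htop 4 (by norm_num), Submodule.mem_bot] at h
    obtain ⟨e, he⟩ := exists_quotient_algEquiv_of_basis (Polynomial.adjoin_X (R := K))
      (Ideal.span {(Polynomial.X : Polynomial K) ^ 2}) (Polynomial.aeval w)
      (by
        intro r hr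
        obtain ⟨q, rfl⟩ := Ideal.mem_span_singleton'.1 hr
        simp [pow_two, hww])
      ![1, Polynomial.X] (Submodule.subset_span ⟨0, rfl⟩)
      (by
        rintro _ rfl i
        fin_cases i
        · exact Submodule.mem_sup_left (Submodule.subset_span ⟨1, by simp⟩)
        · exact Submodule.mem_sup_right (Ideal.subset_span (by simp [pow_two])))
      (by
        rw [Fintype.linearIndependent_iff]
        intro g hg
        simp [Fin.sum_univ_succ] at hg
        obtain ⟨k0, -, k2⟩ := eq_zero_of_add_add_eq_zero 𝒜 ((𝒜 0).smul_mem (g 0) hone0)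
          (zero_mem _) ((𝒜 2).smul_mem (g 1) hw) (by simpa using hg)
        intro i
        fin_cases i
        · exact (smul_eq_zero.1 k0).resolve_right hone
        · exact (smul_eq_zero.1 k2).resolve_right hw0)
      (by
        intro x _
        obtain ⟨p, hp, q, hq, r, hr, rfl⟩ := exists_add_add_eq_of_graded 𝒜 htop x
        obtain ⟨c, rfl⟩ := hrep0 p hp
        obtain ⟨d, rfl⟩ := hrep2 hw hw0 hr
        rw [h1, Submodule.mem_bot] at hq
        rw [Submodule.mem_span_range_iff_exists_fun]
        exact ⟨![c, d], by simp [Fin.sum_univ_succ, hq]⟩)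
    exact ⟨e, by rw [he]; simpa using hw⟩
  · rintro rfl
    obtain ⟨u, hu, hu0⟩ := exists_mem_ne_zero_of_finrank_eq_one ha
    have hrep1 {x : A} (hx : x ∈ 𝒜 1) := exists_smul_eq_of_mem_of_finrank_eq_one ha hu hu0 hx
    have huu : u * u ≠ 0 := by
      obtain ⟨y, hy, huy⟩ := hnd u hu hu0
      obtain ⟨c, rfl⟩ := hrep1 hy
      intro h
      simp [h] at huy
    have huu2 := mul_mem_graded_two 𝒜 hu hu
    obtain ⟨e, he⟩ := exists_quotient_algEquiv_of_basis (Polynomial.adjoin_X (R := K))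
      (Ideal.span {(Polynomial.X : Polynomial K) ^ 3}) (Polynomial.aeval u)
      (by
        intro r hr
        obtain ⟨q, rfl⟩ := Ideal.mem_span_singleton'.1 hr
        have : u ^ 3 = 0 := by linear_combination hmul0 hu huu2
        simp [this])
      ![1, Polynomial.X, Polynomial.X ^ 2] (Submodule.subset_span ⟨0, rfl⟩)
      (by
        rintro _ rfl i
        fin_cases i
        · exact Submodule.mem_sup_left (Submodule.subset_span ⟨1, by simp⟩)
        · exact Submodule.mem_sup_left (Submodule.subset_span ⟨2, by simp [pow_two]⟩)
        · exact Submodule.mem_sup_right (Ideal.subset_span (by simp [pow_succ'])))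
      (by
        rw [Fintype.linearIndependent_iff]
        intro g hg
        simp [Fin.sum_univ_succ] at hg
        obtain ⟨k0, k1, k2⟩ := eq_zero_of_add_add_eq_zero 𝒜 ((𝒜 0).smul_mem (g 0) hone0)
          ((𝒜 1).smul_mem (g 1) hu) ((𝒜 2).smul_mem (g 2) huu2)
          (by simpa [pow_two, add_assoc] using hg)
        intro i
        fin_cases i
        · exact (smul_eq_zero.1 k0).resolve_right hone
        · exact (smul_eq_zero.1 k1).resolve_right hu0
        · exact (smul_eq_zero.1 k2).resolve_right huu)
      (by
        intro x _
        obtain ⟨p, hp, q, hq, r, hr, rfl⟩ := exists_add_add_eq_of_graded 𝒜 htop x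
        obtain ⟨c, rfl⟩ := hrep0 p hp
        obtain ⟨d, rfl⟩ := hrep1 hq
        obtain ⟨t, rfl⟩ := hrep2 huu2 huu hr
        rw [Submodule.mem_span_range_iff_exists_fun]
        exact ⟨![c, d, t], by simp [Fin.sum_univ_succ, pow_two, add_assoc]⟩)
    exact ⟨e, by rw [he]; simpa using hu⟩
  · rintro rfl
    obtain ⟨u, hu, v, hv, huv, huu, hvv, hrep1⟩ := exists_orthogonal_pair 𝒜 h2 hnd ha
    have huu2 := mul_mem_graded_two 𝒜 hu hu
    have hvv2 := mul_mem_graded_two 𝒜 hv hv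
    obtain ⟨l, hl⟩ := hrep2 hvv2 hvv huu2
    have hl0 : l ≠ 0 := by
      rintro rfl
      exact huu (by rw [← hl, zero_smul])
    set I : Ideal (MvPolynomial (Fin 2) K) :=
      Ideal.span {MvPolynomial.X 0 * MvPolynomial.X 1,
        (MvPolynomial.X 0 : MvPolynomial (Fin 2) K) ^ 2 -
          MvPolynomial.C l * MvPolynomial.X 1 ^ 2} with hIdef
    have hXY : (MvPolynomial.X 0 * MvPolynomial.X 1 : MvPolynomial (Fin 2) K) ∈ I :=
      Ideal.subset_span (by simp)
    have hXX : ((MvPolynomial.X 0 : MvPolynomial (Fin 2) K) ^ 2 -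
        MvPolynomial.C l * MvPolynomial.X 1 ^ 2) ∈ I := Ideal.subset_span (by simp)
    have hYYY : (MvPolynomial.X 1 ^ 3 : MvPolynomial (Fin 2) K) ∈ I := by
      have hC : (MvPolynomial.C l⁻¹ * MvPolynomial.C l : MvPolynomial (Fin 2) K) = 1 := by
        rw [← MvPolynomial.C_mul, inv_mul_cancel₀ hl0, MvPolynomial.C_1]
      have h := sub_mem (I.mul_mem_left (MvPolynomial.C l⁻¹ * MvPolynomial.X 0) hXY)
        (I.mul_mem_left (MvPolynomial.C l⁻¹ * MvPolynomial.X 1) hXX)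
      convert h using 1
      linear_combination -(MvPolynomial.X 1 ^ 3) * hC
    obtain ⟨e, he⟩ := exists_quotient_algEquiv_of_basis
      (MvPolynomial.adjoin_range_X (R := K) (σ := Fin 2)) I (MvPolynomial.aeval ![u, v])
      (by
        intro r hr
        have hle : I ≤ RingHom.ker (MvPolynomial.aeval ![u, v] : _ →ₐ[K] A) := by
          rw [hIdef, Ideal.span_le]
          rintro x (rfl | rfl)
          · simp [RingHom.mem_ker, huv]
          · simp [RingHom.mem_ker, pow_two, ← hl, Algebra.smul_def]
        exact hle hr)
      ![1, MvPolynomial.X 0, MvPolynomial.X 1, MvPolynomial.X 1 ^ 2]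
      (Submodule.subset_span ⟨0, rfl⟩)
      (by
        rintro _ ⟨j, rfl⟩ i
        fin_cases j <;> fin_cases i
        · exact Submodule.mem_sup_left (Submodule.subset_span ⟨1, by simp⟩)
        · refine Submodule.mem_sup.2 ⟨l • MvPolynomial.X 1 ^ 2,
            Submodule.smul_mem _ _ (Submodule.subset_span ⟨3, by simp⟩), _, hXX, ?_⟩
          simp [MvPolynomial.smul_eq_C_mul, pow_two]
        · exact Submodule.mem_sup_right hXY
        · refine Submodule.mem_sup_right ?_
          simpa [pow_two, mul_assoc] using I.mul_mem_right (MvPolynomial.X 1) hXY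
        · exact Submodule.mem_sup_left (Submodule.subset_span ⟨2, by simp⟩)
        · refine Submodule.mem_sup_right ?_
          simpa [mul_comm] using hXY
        · exact Submodule.mem_sup_left (Submodule.subset_span ⟨3, by simp [pow_two]⟩)
        · refine Submodule.mem_sup_right ?_
          simpa [pow_succ', mul_assoc] using hYYY)
      (by
        rw [Fintype.linearIndependent_iff]
        intro g hg
        simp [Fin.sum_univ_succ] at hg
        obtain ⟨k0, k1, k2⟩ := eq_zero_of_add_add_eq_zero 𝒜 ((𝒜 0).smul_mem (g 0) hone0)
          (add_mem ((𝒜 1).smul_mem (g 1) hu) ((𝒜 1).smul_mem (g 2) hv))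
          ((𝒜 2).smul_mem (g 3) hvv2) (by simpa [pow_two, add_assoc] using hg)
        have ku : g 1 • (u * u) = 0 := by
          simpa [mul_add, huv] using congrArg (u * ·) k1
        have kv : g 2 • (v * v) = 0 := by
          simpa [mul_add, huv, mul_comm v u] using congrArg (v * ·) k1
        intro i
        fin_cases i
        · exact (smul_eq_zero.1 k0).resolve_right hone
        · exact (smul_eq_zero.1 ku).resolve_right huu
        · exact (smul_eq_zero.1 kv).resolve_right hvv
        · exact (smul_eq_zero.1 k2).resolve_right hvv)
      (by
        intro x _
        obtain ⟨p, hp, q, hq, r, hr, rfl⟩ := exists_add_add_eq_of_graded 𝒜 htop x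
        obtain ⟨c, rfl⟩ := hrep0 p hp
        obtain ⟨s, t, rfl⟩ := hrep1 q hq
        obtain ⟨d, rfl⟩ := hrep2 hvv2 hvv hr
        rw [Submodule.mem_span_range_iff_exists_fun]
        exact ⟨![c, s, t, d], by simp [Fin.sum_univ_succ, pow_two, add_assoc]⟩)
    exact ⟨l, hl0, e, by rw [he]; simpa using hu, by rw [he]; simpa using hv⟩
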